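/- For an N_r×N_t complex matrix H with compact SVD H = U Σ V^H (Σ positive definite diagonal of size N_t, U has orthonormal columns), and any N_r×L matrix F with orthonormal columns (L ≤ N_t), the smallest eigenvalue of F^H H H^H F satisfies λ_min(F^H H H^H F) ≥ λ_min(Σ²) · λ_min(U^H F F^H U). -/

import Mathlib

open Matrix

/-- squared Euclidean norm -/
def nsq {n : ℕ} (v : Fin n → ℂ) : ℝ := (star v ⬝ᵥ v).re

lemma nsq_eq {n : ℕ} (v : Fin n → ℂ) : nsq v = ∑ i, Complex.normSq (v i) := by
  simp only [nsq, dotProduct, Complex.re_sum, Pi.star_apply, Complex.star_def]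
  refine Finset.sum_congr rfl fun i _ => ?_
  rw [← Complex.normSq_eq_conj_mul_self, Complex.ofReal_re]

lemma nsq_nonneg {n : ℕ} (v : Fin n → ℂ) : 0 ≤ nsq v := by
  rw [nsq_eq]
  exact Finset.sum_nonneg fun i _ => Complex.normSq_nonneg _

lemma nsq_mulVec {m n : ℕ} (K : Matrix (Fin m) (Fin n) ℂ) (v : Fin n → ℂ) :
    nsq (K *ᵥ v) = (star v ⬝ᵥ ((Kᴴ * K) *ᵥ v)).re := by
  rw [nsq, star_mulVec, ← dotProduct_mulVec, mulVec_mulVec]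

open scoped ComplexOrder in
lemma rayleigh {n : ℕ} (B : Matrix (Fin n) (Fin n) ℂ) (hB : B.IsHermitian) (b : ℝ)
    (hb : ∀ i, b ≤ hB.eigenvalues i) (y : Fin n → ℂ) :
    b * nsq y ≤ (star y ⬝ᵥ (B *ᵥ y)).re := by
  have hC : (B - algebraMap ℝ (Matrix (Fin n) (Fin n) ℂ) b).IsHermitian := by
    refine hB.sub ?_
    exact (IsSelfAdjoint.all b).algebraMap _
  have hP : (B - algebraMap ℝ (Matrix (Fin n) (Fin n) ℂ) b).PosSemidef := by
    rw [hC.posSemidef_iff_eigenvalues_nonneg]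
    intro i
    have h1 : hC.eigenvalues i ∈ spectrum ℝ (B - algebraMap ℝ (Matrix (Fin n) (Fin n) ℂ) b) := by
      rw [hC.spectrum_real_eq_range_eigenvalues]
      exact ⟨i, rfl⟩
    rw [← spectrum.sub_singleton_eq, hB.spectrum_real_eq_range_eigenvalues] at h1
    obtain ⟨u, ⟨j, rfl⟩, w, hw, he⟩ := h1
    rw [Set.mem_singleton_iff] at hw
    subst hw
    have := hb j
    simp only at he
    simp only [Pi.zero_apply]
    linarith
  have h := hP.dotProduct_mulVec_nonneg y
  rw [Algebra.algebraMap_eq_smul_one, sub_mulVec, smul_mulVec, one_mulVec, dotProduct_sub,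
    dotProduct_smul] at h
  have h2 := (Complex.le_def.1 h).1
  simp only [Complex.zero_re, Complex.sub_re, Complex.real_smul, Complex.re_ofReal_mul] at h2
  unfold nsq
  linarith

lemma key {m l : ℕ} (hlm : l ≤ m) (M : Matrix (Fin m) (Fin l) ℂ) (b : ℝ) (hb : 0 < b)
    (h : ∀ y, b * nsq y ≤ nsq (Mᴴ *ᵥ y)) (x : Fin l → ℂ) : b * nsq x ≤ nsq (M *ᵥ x) := by
  have hinj : Function.Injective (Mᴴ.mulVecLin) := by
    rw [← LinearMap.ker_eq_bot, LinearMap.ker_eq_bot']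
    intro y hy
    have h1 := h y
    rw [mulVecLin_apply] at hy
    rw [hy] at h1
    have h0 : nsq (0 : Fin l → ℂ) = 0 := by simp [nsq]
    have h2 : nsq y = 0 := by
      have := nsq_nonneg y
      nlinarith
    rw [nsq_eq, Finset.sum_eq_zero_iff_of_nonneg (fun i _ => Complex.normSq_nonneg _)] at h2
    funext i
    exact Complex.normSq_eq_zero.1 (h2 i (Finset.mem_univ i))
  have hle := LinearMap.finrank_le_finrank_of_injective hinj
  simp only [Module.finrank_fin_fun] at hle
  have hsurj := (LinearMap.injective_iff_surjective_of_finrank_eq_finrank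
    (by simp only [Module.finrank_fin_fun]; omega)).1 hinj
  obtain ⟨y, rfl⟩ := hsurj x
  rw [mulVecLin_apply]
  have hy := h y
  have hn := nsq_nonneg (M *ᵥ (Mᴴ *ᵥ y) - b • y)
  have e1 : star y ⬝ᵥ (M *ᵥ (Mᴴ *ᵥ y)) = star (Mᴴ *ᵥ y) ⬝ᵥ (Mᴴ *ᵥ y) := by
    rw [star_mulVec, conjTranspose_conjTranspose, ← dotProduct_mulVec]
  have e2 : star (M *ᵥ (Mᴴ *ᵥ y)) ⬝ᵥ y = star (Mᴴ *ᵥ y) ⬝ᵥ (Mᴴ *ᵥ y) := by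
    rw [star_mulVec, ← dotProduct_mulVec]
  have e : nsq (M *ᵥ (Mᴴ *ᵥ y) - b • y)
      = nsq (M *ᵥ (Mᴴ *ᵥ y)) - 2 * b * nsq (Mᴴ *ᵥ y) + b ^ 2 * nsq y := by
    unfold nsq
    rw [star_sub, star_smul, sub_dotProduct, dotProduct_sub, dotProduct_sub, smul_dotProduct,
      smul_dotProduct, dotProduct_smul, dotProduct_smul, e1, e2]
    simp only [Complex.sub_re, Complex.real_smul, Complex.re_ofReal_mul, star_trivial]
    ring
  rw [e] at hn
  nlinarith

/-- For `H = U Σ Vᴴ` (compact SVD, `Σ` positive diagonal, `U` with orthonormal columns)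
and any `F` with orthonormal columns, `λ_min(Fᴴ H Hᴴ F) ≥ λ_min(Σ²) ⬝ λ_min(Uᴴ F Fᴴ U)`. -/
theorem stmt_2 (Nr Nt L : ℕ) (hL : 0 < L) (hLNt : L ≤ Nt) (hNtNr : Nt ≤ Nr)
    (H U : Matrix (Fin Nr) (Fin Nt) ℂ) (V : Matrix (Fin Nt) (Fin Nt) ℂ)
    (σ : Fin Nt → ℝ) (hσ : ∀ i, 0 < σ i)
    (hSVD : H = U * Matrix.diagonal (fun i => (σ i : ℂ)) * Vᴴ)
    (hU : Uᴴ * U = 1) (hV : Vᴴ * V = 1)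
    (F : Matrix (Fin Nr) (Fin L) ℂ) (hF : Fᴴ * F = 1)
    (hA : (Fᴴ * H * Hᴴ * F).IsHermitian)
    (hB : (Uᴴ * F * Fᴴ * U).IsHermitian) :
    (⨅ i, σ i ^ 2) * ⨅ i, hB.eigenvalues i ≤ ⨅ i, hA.eigenvalues i := by
  have : Nonempty (Fin L) := ⟨⟨0, hL⟩⟩
  have : Nonempty (Fin Nt) := ⟨⟨0, by omega⟩⟩
  set b := ⨅ i, hB.eigenvalues i with hbdef
  set s := ⨅ i, σ i ^ 2 with hsdef
  have hbi : ∀ i, b ≤ hB.eigenvalues i := fun i => ciInf_le (Set.finite_range _).bddBelow i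
  have hsi : ∀ i, s ≤ σ i ^ 2 := fun i => ciInf_le (Set.finite_range _).bddBelow i
  have hs0 : 0 ≤ s := le_ciInf fun i => sq_nonneg _
  refine le_ciInf fun i => ?_
  rw [hA.eigenvalues_eq i]
  set x : Fin L → ℂ := ⇑(hA.eigenvectorBasis i) with hx
  have hx1 : nsq x = 1 := by
    have h1 := hA.eigenvectorBasis.orthonormal.1 i
    have h2 := EuclideanSpace.norm_sq_eq (hA.eigenvectorBasis i)
    rw [h1] at h2
    rw [nsq_eq]
    simp only [Complex.normSq_eq_norm_sq]
    rw [hx, ← h2]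
    norm_num
  set D : Matrix (Fin Nt) (Fin Nt) ℂ := Matrix.diagonal (fun i => (σ i : ℂ)) with hD
  have hDh : Dᴴ = D := by
    rw [hD, diagonal_conjTranspose]
    congr 1
    funext j
    simp
  have hAe : Fᴴ * H * Hᴴ * F = (D * (Uᴴ * F))ᴴ * (D * (Uᴴ * F)) := by
    rw [hSVD]
    simp only [conjTranspose_mul, conjTranspose_conjTranspose, hDh, Matrix.mul_assoc]
    rw [← Matrix.mul_assoc Vᴴ V, hV, Matrix.one_mul]
  have hval : RCLike.re (star x ⬝ᵥ ((Fᴴ * H * Hᴴ * F) *ᵥ x)) = nsq (D *ᵥ ((Uᴴ * F) *ᵥ x)) := by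
    rw [mulVec_mulVec, nsq_mulVec, ← hAe]
    rfl
  rw [hval]
  have hDs : s * nsq ((Uᴴ * F) *ᵥ x) ≤ nsq (D *ᵥ ((Uᴴ * F) *ᵥ x)) := by
    rw [nsq_eq, nsq_eq, Finset.mul_sum]
    refine Finset.sum_le_sum fun j _ => ?_
    rw [hD, mulVec_diagonal, Complex.normSq_mul, Complex.normSq_ofReal, ← sq]
    exact mul_le_mul_of_nonneg_right (hsi j) (Complex.normSq_nonneg _)
  rcases le_or_gt b 0 with hb | hb
  · exact (mul_nonpos_of_nonneg_of_nonpos hs0 hb).trans (nsq_nonneg _)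
  · have hk := key hLNt (Uᴴ * F) b hb (fun y => by
      rw [nsq_mulVec]
      have := rayleigh _ hB b hbi y
      simpa only [conjTranspose_mul, conjTranspose_conjTranspose, Matrix.mul_assoc] using this) x
    rw [hx1, mul_one] at hk
    exact (mul_le_mul_of_nonneg_left hk hs0).trans hDs
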